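/- Let (𝔤,⟨·,·⟩) be a metric Lie algebra whose derived algebra is one-dimensional and spanned by a unit vector e, with Γ = e^⊥, a ∈ Γ satisfying [x,e] = ⟨a,x⟩e for all x ∈ Γ, and skew-adjoint f : Γ → Γ satisfying [x,y] = ⟨f(x),y⟩e for all x,y ∈ Γ. Then the sectional curvature K̃ of the tangent algebra T𝔤 satisfies: for all orthonormal x, y ∈ Γ, K̃(x^c,y^c) = K̃(x^c,y^v) = −(3/4)⟨f(x),y⟩² and K̃(x^v,y^v) = 0; and for every unit vector x ∈ Γ, K̃(x^c,e^c) = K̃(x^c,e^v) = (1/4)‖f(x)‖² − ⟨a,x⟩², K̃(x^v,e^c) = −(3/4)⟨a,x⟩², and K̃(x^v,e^v) = (1/4)‖f(x)‖² + (1/4)⟨a,x⟩². -/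

import Mathlib

/-- Bracket of the tangent Lie algebra `T𝔤 = 𝔤 × 𝔤`. -/
def tangentBracket {G : Type*} [LieRing G] (p q : G × G) : G × G :=
  (⁅p.1, q.1⁆, ⁅p.1, q.2⁆ + ⁅p.2, q.1⁆)

/-- The lifted inner product on `T𝔤 = 𝔤 × 𝔤`. -/
def tangentInner {G : Type*} [AddCommGroup G] [Module ℝ G]
    (inn : G →ₗ[ℝ] G →ₗ[ℝ] ℝ) (p q : G × G) : ℝ :=
  inn p.1 q.1 + inn p.2 q.2

/-- Curvature tensor `R(x,y)z = ∇ₓ∇_y z − ∇_y∇ₓ z − ∇_{[x,y]} z` of a product `∇`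
with respect to a bracket `br`. -/
def curvature {A : Type*} [AddCommGroup A] (br : A → A → A) (nab : A → A → A)
    (x y z : A) : A :=
  nab x (nab y z) - nab y (nab x z) - nab (br x y) z

/-- Sectional curvature `K(x,y) = ⟨R(x,y)y,x⟩ / (⟨x,x⟩⟨y,y⟩ − ⟨x,y⟩²)`. -/
noncomputable def sectional {A : Type*} (ip : A → A → ℝ) (R : A → A → A → A)
    (x y : A) : ℝ :=
  ip (R x y y) x / (ip x x * ip y y - ip x y ^ 2)

section RankOneBracket

variable {G : Type*} [LieRing G] [LieAlgebra ℝ G] {inn : G →ₗ[ℝ] G →ₗ[ℝ] ℝ}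

/-- The operator `F` with `[u, v] = ⟨F u, v⟩ e` on all of `𝔤`, assembled from `f`, `a` and `e`. -/
def bracketOperator (inn : G →ₗ[ℝ] G →ₗ[ℝ] ℝ) (e a : G) (f : G →ₗ[ℝ] G) : G →ₗ[ℝ] G :=
  f ∘ₗ (LinearMap.id - (inn e).smulRight e) + (inn a).smulRight e - (inn e).smulRight a

theorem bracketOperator_apply (e a : G) (f : G →ₗ[ℝ] G) (u : G) :
    bracketOperator inn e a f u = f (u - inn e u • e) + inn a u • e - inn e u • a := by
  simp [bracketOperator]

theorem lie_eq_inn_bracketOperator_smul (hsymm : ∀ x y : G, inn x y = inn y x)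
    {e : G} (hunit : inn e e = 1) {a : G} (haG : inn e a = 0)
    (haxe : ∀ x : G, inn e x = 0 → ⁅x, e⁆ = inn a x • e)
    {f : G →ₗ[ℝ] G} (hfG : ∀ x : G, inn e x = 0 → inn e (f x) = 0)
    (hfbr : ∀ x y : G, inn e x = 0 → inn e y = 0 → ⁅x, y⁆ = inn (f x) y • e) (u v : G) :
    ⁅u, v⁆ = inn (bracketOperator inn e a f u) v • e := by
  have hproj : ∀ w : G, inn e (w - inn e w • e) = 0 := fun w => by simp [hunit]
  have hae : inn a e = 0 := by rw [hsymm, haG]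
  have hfe : inn (f (u - inn e u • e)) e = 0 := by rw [hsymm]; exact hfG _ (hproj u)
  have hu : ⁅u, e⁆ = inn a u • e := by
    have := haxe _ (hproj u)
    simpa [hae] using this
  have hv : ⁅e, v⁆ = -(inn a v • e) := by
    have := haxe _ (hproj v)
    rw [← lie_skew, neg_inj]
    simpa [hae] using this
  have huv := hfbr _ _ (hproj u) (hproj v)
  rw [bracketOperator_apply]
  simp only [sub_lie, lie_sub, smul_lie, lie_smul, lie_self, hu, hv, smul_zero, sub_zero,
    map_sub (inn (f (u - inn e u • e))), map_smul (inn (f (u - inn e u • e))), hfe] at huv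
  rw [sub_sub, sub_eq_iff_eq_add] at huv
  rw [huv]
  simp only [map_add, map_sub, map_smul, LinearMap.add_apply, LinearMap.sub_apply,
    LinearMap.smul_apply, smul_eq_mul]
  module

theorem inn_map_skew {e : G} (hunit : inn e e = 1) {F : G →ₗ[ℝ] G}
    (hF : ∀ u v : G, ⁅u, v⁆ = inn (F u) v • e) (u v : G) : inn (F u) v = -inn (F v) u := by
  have h := congrArg (inn e) (lie_skew u v)
  simp only [hF, map_neg, map_smul, hunit, smul_eq_mul, mul_one] at h
  linarith

theorem eq_of_forall_tangentInner_eq (hpos : ∀ x : G, x ≠ 0 → 0 < inn x x) {p q : G × G}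
    (h : ∀ r, tangentInner inn p r = tangentInner inn q r) : p = q := by
  have hsep : ∀ {u v : G}, (∀ w, inn u w = inn v w) → u = v := fun {u v} huv => by
    by_contra hne
    have := hpos (u - v) (sub_ne_zero.mpr hne)
    rw [map_sub inn, LinearMap.sub_apply, huv, sub_self] at this
    exact this.false
  exact Prod.ext (hsep fun w => by simpa [tangentInner] using h (w, 0))
    (hsep fun w => by simpa [tangentInner] using h (0, w))

/-- The Levi-Civita product of `T𝔤` when `[u, v] = ⟨F u, v⟩ e`. -/
theorem tangent_leviCivita_eq (hpos : ∀ x : G, x ≠ 0 → 0 < inn x x) {e : G} (hunit : inn e e = 1) {F : G →ₗ[ℝ] G}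
    (hF : ∀ u v : G, ⁅u, v⁆ = inn (F u) v • e) {nab : G × G → G × G → G × G}
    (hkoszul : ∀ p q r : G × G,
      2 * tangentInner inn (nab p q) r =
        tangentInner inn (tangentBracket p q) r
          - tangentInner inn (tangentBracket q r) p
          + tangentInner inn (tangentBracket r p) q) (p q : G × G) :
    nab p q = (1 / 2 : ℝ) •
      (inn (F p.1) q.1 • e - inn e p.1 • F q.1 - inn e p.2 • F q.2
          - inn e q.1 • F p.1 - inn e q.2 • F p.2,
        (inn (F p.1) q.2 + inn (F p.2) q.1) • e - inn e p.2 • F q.1 - inn e q.2 • F p.1) := by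
  refine eq_of_forall_tangentInner_eq hpos fun r => ?_
  have h := hkoszul p q r
  simp only [tangentBracket, hF, tangentInner, map_add, map_smul,
    LinearMap.add_apply, LinearMap.smul_apply, smul_eq_mul] at h
  rw [inn_map_skew hunit hF r.1 p.1, inn_map_skew hunit hF r.1 p.2,
    inn_map_skew hunit hF r.2 p.1] at h
  simp only [tangentInner, Prod.smul_mk, map_sub, map_smul,
    LinearMap.sub_apply, LinearMap.smul_apply, smul_eq_mul]
  linear_combination h / 2

end RankOneBracket

/-- Let `(𝔤,⟨·,·⟩)` be a metric Lie algebra whose derived algebra is one-dimensional and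
spanned by a unit vector `e`, with `Γ = e^⊥`, `a ∈ Γ` satisfying `[x,e] = ⟨a,x⟩e` for all
`x ∈ Γ`, and skew-adjoint `f : Γ → Γ` satisfying `[x,y] = ⟨f(x),y⟩e` for all `x,y ∈ Γ`.
Then the sectional curvature `K̃` of the tangent algebra `T𝔤` satisfies: for orthonormal
`x, y ∈ Γ`, `K̃(x^c,y^c) = K̃(x^c,y^v) = −(3/4)⟨f(x),y⟩²` and `K̃(x^v,y^v) = 0`; for every
unit vector `x ∈ Γ`, `K̃(x^c,e^c) = K̃(x^c,e^v) = (1/4)‖f(x)‖² − ⟨a,x⟩²`,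
`K̃(x^v,e^c) = −(3/4)⟨a,x⟩²`, and `K̃(x^v,e^v) = (1/4)‖f(x)‖² + (1/4)⟨a,x⟩²`. -/
theorem oneDimCommutator_tangent_sectional_formulas
    {G : Type*} [LieRing G] [LieAlgebra ℝ G] [Module.Finite ℝ G]
    (inn : G →ₗ[ℝ] G →ₗ[ℝ] ℝ)
    (hsymm : ∀ x y : G, inn x y = inn y x)
    (hpos : ∀ x : G, x ≠ 0 → 0 < inn x x)
    (e : G) (hunit : inn e e = 1)
    (hder : Submodule.span ℝ {z : G | ∃ x y : G, ⁅x, y⁆ = z} =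
      Submodule.span ℝ ({e} : Set G))
    (a : G) (haG : inn e a = 0)
    (haxe : ∀ x : G, inn e x = 0 → ⁅x, e⁆ = inn a x • e)
    (f : G →ₗ[ℝ] G)
    (hfG : ∀ x : G, inn e x = 0 → inn e (f x) = 0)
    (hskew : ∀ x y : G, inn e x = 0 → inn e y = 0 → inn (f x) y = -inn x (f y))
    (hfbr : ∀ x y : G, inn e x = 0 → inn e y = 0 → ⁅x, y⁆ = inn (f x) y • e)
    (tnabla : G × G → G × G → G × G)
    (htkoszul : ∀ p q r : G × G,
      2 * tangentInner inn (tnabla p q) r =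
        tangentInner inn (tangentBracket p q) r
          - tangentInner inn (tangentBracket q r) p
          + tangentInner inn (tangentBracket r p) q) :
    (∀ x y : G, inn e x = 0 → inn e y = 0 →
      inn x x = 1 → inn y y = 1 → inn x y = 0 →
      sectional (tangentInner inn) (curvature tangentBracket tnabla)
          ((x, 0) : G × G) ((y, 0) : G × G) = -(3/4) * inn (f x) y ^ 2 ∧
      sectional (tangentInner inn) (curvature tangentBracket tnabla)
          ((x, 0) : G × G) ((0, y) : G × G) = -(3/4) * inn (f x) y ^ 2 ∧
      sectional (tangentInner inn) (curvature tangentBracket tnabla)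
          ((0, x) : G × G) ((0, y) : G × G) = 0) ∧
    (∀ x : G, inn e x = 0 → inn x x = 1 →
      sectional (tangentInner inn) (curvature tangentBracket tnabla)
          ((x, 0) : G × G) ((e, 0) : G × G) = (1/4) * inn (f x) (f x) - inn a x ^ 2 ∧
      sectional (tangentInner inn) (curvature tangentBracket tnabla)
          ((x, 0) : G × G) ((0, e) : G × G) = (1/4) * inn (f x) (f x) - inn a x ^ 2 ∧
      sectional (tangentInner inn) (curvature tangentBracket tnabla)
          ((0, x) : G × G) ((e, 0) : G × G) = -(3/4) * inn a x ^ 2 ∧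
      sectional (tangentInner inn) (curvature tangentBracket tnabla)
          ((0, x) : G × G) ((0, e) : G × G) =
        (1/4) * inn (f x) (f x) + (1/4) * inn a x ^ 2) := by
  have hF := lie_eq_inn_bracketOperator_smul hsymm hunit haG haxe hfG hfbr
  have hnab := tangent_leviCivita_eq hpos hunit hF htkoszul
  have hskewF := inn_map_skew hunit hF
  have hFe : bracketOperator inn e a f e = -a := by
    simp [bracketOperator_apply, hunit, hsymm a e, haG]
  have hFx : ∀ x, inn e x = 0 → bracketOperator inn e a f x = f x + inn a x • e := fun x hx => by
    simp [bracketOperator_apply, hx]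
  generalize bracketOperator inn e a f = F at *
  have hxe : ∀ x, inn e x = 0 → inn x e = 0 := fun x hx => by rw [hsymm, hx]
  refine ⟨fun x y hx hy hxx hyy hxy => ?_, fun x hx hxx => ?_⟩
  · have hfxy : inn (F x) y = inn (f x) y := by simp [hFx x hx, hy]
    have hfyx : inn (F y) x = -inn (f x) y := by rw [hskewF, hfxy]
    have hFyy : inn (F y) y = 0 := by linarith [hskewF y y]
    refine ⟨?_, ?_, ?_⟩ <;>
    · simp [sectional, curvature, tangentInner, tangentBracket, hF, hnab, hx, hy, hxx, hyy, hxy,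
        hunit, hfxy, hfyx, hFyy]
      try ring
  · have hfe : inn e (f x) = 0 := hfG x hx
    have hFxx : inn (F x) x = 0 := by linarith [hskewF x x]
    have hFfx : inn (F (f x)) x = -inn (f x) (f x) := by
      rw [hskewF, hFx x hx]; simp [hfe]
    refine ⟨?_, ?_, ?_, ?_⟩ <;>
    · simp [sectional, curvature, tangentInner, tangentBracket, hF, hnab, hx, hxx, haG,
        hunit, hxe x hx, hxe a haG, hFe, hFx x hx, hfe, hxe _ hfe, hFfx]
      try ring
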